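/- arXiv:2105.12379 — 6 statements merged into one kernel-verified Lean document; each statement's English description precedes it below -/
import Mathlib

section
/- Energy identity for the fully discrete stabilized monolithic FSI scheme: Suppose (uᵐ)_{m≥0} ⊆ F, (dᵐ)_{m≥0} ⊆ W_h and ḋ⁰ ∈ W_h are given, set ḋᵐ = ∂_τ dᵐ for m ≥ 1, and suppose the nonnegative reals (δ_m)_{m≥1} are such that for every m ≥ 1 the tested scheme equation ρ_f⟨uᵐ − uᵐ⁻¹, uᵐ⟩_F + δ_m + ρ_s ε⟨ḋᵐ − ḋᵐ⁻¹, ḋᵐ⟩_S + a(dᵐ, dᵐ − dᵐ⁻¹) = 0 holds. Then for every n ≥ 1 the exact energy balance Eⁿ + Dⁿ = E⁰ holds, where Eᵐ = (ρ_f/2)‖uᵐ‖_F² + (ρ_s ε/2)‖ḋᵐ‖_S² + (1/2)‖dᵐ‖_s² and Dⁿ = Σ_{m=1}^{n} δ_m + τ² Σ_{m=1}^{n} [(ρ_f/2)‖∂_τ uᵐ‖_F² + (ρ_s ε/2)‖∂_τ ḋᵐ‖_S² + (1/2)‖∂_τ dᵐ‖_s²]. In particular the scheme is unconditionally stable. 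-/
open RealInnerProductSpace

/-- The polarization identity behind the backward Euler scheme, in a real inner product space. -/
lemma inner_sub_self_eq {E : Type*} [NormedAddCommGroup E] [InnerProductSpace ℝ E] (x y : E) :
    ⟪x - y, x⟫ = (‖x‖ ^ 2 - ‖y‖ ^ 2 + ‖x - y‖ ^ 2) / 2 := by
  rw [norm_sub_sq_real, inner_sub_left, real_inner_self_eq_norm_sq, real_inner_comm]
  ring

/-- The polarization identity behind the backward Euler scheme, for a form that is symmetric and
additive on an additive subgroup. -/
lemma form_sub_self_eq {E : Type*} [AddCommGroup E] (W : AddSubgroup E) (a : E → E → ℝ)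
    (hsymm : ∀ u ∈ W, ∀ v ∈ W, a u v = a v u)
    (hadd : ∀ u ∈ W, ∀ v ∈ W, ∀ w ∈ W, a (u + v) w = a u w + a v w)
    {x y : E} (hx : x ∈ W) (hy : y ∈ W) :
    a x (x - y) = (a x x - a y y + a (x - y) (x - y)) / 2 := by
  have hz : x - y ∈ W := W.sub_mem hx hy
  have hxz := hadd y hy (x - y) hz (x - y) hz
  have hxx := hadd y hy (x - y) hz x hx
  have hxy := hadd y hy (x - y) hz y hy
  rw [add_sub_cancel] at hxz hxx hxy
  have := hsymm x hx y hy
  have := hsymm x hx (x - y) hz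
  have := hsymm y hy (x - y) hz
  linarith

/-- Scaling by `1 / τ` divides a squared norm by `τ ^ 2`. -/
lemma sq_mul_norm_one_div_smul_sq {E : Type*} [NormedAddCommGroup E] [NormedSpace ℝ E]
    {τ : ℝ} (hτ : τ ≠ 0) (x : E) : τ ^ 2 * ‖(1 / τ) • x‖ ^ 2 = ‖x‖ ^ 2 := by
  rw [norm_smul, mul_pow, Real.norm_eq_abs, sq_abs]
  field_simp

/-- Energy identity `Eⁿ + Dⁿ = E⁰` for the fully discrete stabilized monolithic
FSI scheme: the scheme is unconditionally stable. -/
theorem monolithic_scheme_energy_identity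
    {F S : Type*}
    [NormedAddCommGroup F] [InnerProductSpace ℝ F] [CompleteSpace F]
    [NormedAddCommGroup S] [InnerProductSpace ℝ S] [CompleteSpace S]
    (Wh : Submodule ℝ S) [FiniteDimensional ℝ Wh]
    (a : S → S → ℝ)
    (hsymm : ∀ u ∈ Wh, ∀ v ∈ Wh, a u v = a v u)
    (hadd : ∀ u ∈ Wh, ∀ v ∈ Wh, ∀ w ∈ Wh, a (u + v) w = a u w + a v w)
    (hsmul : ∀ (c : ℝ), ∀ u ∈ Wh, ∀ w ∈ Wh, a (c • u) w = c * a u w)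
    (hpos : ∀ w ∈ Wh, w ≠ 0 → 0 < a w w)
    (ρf ρs ε τ : ℝ) (hρf : 0 < ρf) (hρs : 0 < ρs) (hε : 0 < ε) (hτ : 0 < τ)
    (u : ℕ → F) (d ddot : ℕ → S) (δ : ℕ → ℝ)
    (hd_mem : ∀ m, d m ∈ Wh) (hddot_mem : ∀ m, ddot m ∈ Wh)
    (hδ : ∀ m, 1 ≤ m → 0 ≤ δ m)
    (hddot : ∀ m, 1 ≤ m → ddot m = (1 / τ) • (d m - d (m - 1)))
    (hscheme : ∀ m, 1 ≤ m →
      ρf * ⟪u m - u (m - 1), u m⟫ + δ m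
        + ρs * ε * ⟪ddot m - ddot (m - 1), ddot m⟫
        + a (d m) (d m - d (m - 1)) = 0) :
    ∀ n, 1 ≤ n →
      (ρf / 2 * ‖u n‖ ^ 2 + ρs * ε / 2 * ‖ddot n‖ ^ 2 + 1 / 2 * a (d n) (d n))
        + ((∑ m ∈ Finset.Icc 1 n, δ m)
          + τ ^ 2 * ∑ m ∈ Finset.Icc 1 n,
              (ρf / 2 * ‖(1 / τ) • (u m - u (m - 1))‖ ^ 2
                + ρs * ε / 2 * ‖(1 / τ) • (ddot m - ddot (m - 1))‖ ^ 2
                + 1 / 2 * a ((1 / τ) • (d m - d (m - 1))) ((1 / τ) • (d m - d (m - 1)))))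
      = (ρf / 2 * ‖u 0‖ ^ 2 + ρs * ε / 2 * ‖ddot 0‖ ^ 2 + 1 / 2 * a (d 0) (d 0)) := by
  have hform : ∀ w ∈ Wh, τ ^ 2 * a ((1 / τ) • w) ((1 / τ) • w) = a w w := by
    intro w hw
    have hw' : (1 / τ) • w ∈ Wh := Wh.smul_mem _ hw
    rw [hsmul _ w hw _ hw', hsymm w hw _ hw', hsmul _ w hw w hw]
    field_simp
  have hstep : ∀ k, ρf / 2 * ‖u (k + 1)‖ ^ 2 + ρs * ε / 2 * ‖ddot (k + 1)‖ ^ 2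
        + 1 / 2 * a (d (k + 1)) (d (k + 1))
        + (δ (k + 1) + τ ^ 2 * (ρf / 2 * ‖(1 / τ) • (u (k + 1) - u k)‖ ^ 2
          + ρs * ε / 2 * ‖(1 / τ) • (ddot (k + 1) - ddot k)‖ ^ 2
          + 1 / 2 * a ((1 / τ) • (d (k + 1) - d k)) ((1 / τ) • (d (k + 1) - d k))))
      = ρf / 2 * ‖u k‖ ^ 2 + ρs * ε / 2 * ‖ddot k‖ ^ 2 + 1 / 2 * a (d k) (d k) := by
    intro k
    have h := hscheme (k + 1) k.succ_pos
    rw [add_tsub_cancel_right, inner_sub_self_eq, inner_sub_self_eq,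
      form_sub_self_eq Wh.toAddSubgroup a hsymm hadd (hd_mem _) (hd_mem _)] at h
    linear_combination h
      + ρf / 2 * sq_mul_norm_one_div_smul_sq hτ.ne' (u (k + 1) - u k)
      + ρs * ε / 2 * sq_mul_norm_one_div_smul_sq hτ.ne' (ddot (k + 1) - ddot k)
      + 1 / 2 * hform _ (Wh.sub_mem (hd_mem (k + 1)) (hd_mem k))
  intro n hn
  clear hn
  induction n with
  | zero => simp
  | succ k ih =>
    rw [Finset.sum_Icc_succ_top k.succ_pos, Finset.sum_Icc_succ_top k.succ_pos,
      add_tsub_cancel_right]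
    linear_combination ih + hstep k
end

section
/- Conditional stability of the semi-implicit scheme without solid correction (Algorithm 2) with second-order extrapolation: Suppose (uᵐ)_{m≥0} ⊆ F, (ḋᵐ)_{m≥0} ⊆ W_h and d⁰ ∈ W_h are given, set dᵐ = dᵐ⁻¹ + τḋᵐ for m ≥ 1, and suppose the nonnegative reals (δ_m)_{m≥1} are such that for every m ≥ 1 the tested scheme equation ρ_f⟨uᵐ − uᵐ⁻¹, uᵐ⟩_F + δ_m + ρ_s ε⟨ḋᵐ − ḋᵐ⁻¹, ḋᵐ⟩_S + a(dᵐ⁻¹ + τḋᵐ⁻¹, dᵐ − dᵐ⁻¹) = 0 holds (the elastic force is evaluated at the extrapolation d^{m⋆} = dᵐ⁻¹ + τḋᵐ⁻¹). Assume the CFL-type condition: there exists α > 0 such that τ‖w‖_s² ≤ α‖w‖_S² for all w ∈ W_h and τα < ρ_s ε. Then for every n ≥ 1: Eⁿ + Σ_{m=1}^{n} δ_m + τ² Σ_{m=1}^{n} [(ρ_f/2)‖∂_τ uᵐ‖_F² + ((ρ_s ε − τα)/2)‖∂_τ ḋᵐ‖_S²] ≤ exp(nτα/(ρ_s ε − τα))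 · E⁰, where Eᵐ = (ρ_f/2)‖uᵐ‖_F² + (ρ_s ε/2)‖ḋᵐ‖_S² + (1/2)‖dᵐ‖_s². -/
open RealInnerProductSpace

/-- The energy balance of one semi-implicit step: expansion of `a (x + τ • w) (τ • v)` for a form
`a` that is bilinear and symmetric on a subspace. -/
lemma extrapolated_form_eq {S : Type*} [AddCommGroup S] [Module ℝ S] (W : Submodule ℝ S)
    (a : S → S → ℝ)
    (hsymm : ∀ u ∈ W, ∀ v ∈ W, a u v = a v u)
    (hadd : ∀ u ∈ W, ∀ v ∈ W, ∀ w ∈ W, a (u + v) w = a u w + a v w)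
    (hsmul : ∀ (c : ℝ), ∀ u ∈ W, ∀ w ∈ W, a (c • u) w = c * a u w)
    (τ : ℝ) {x v w : S} (hx : x ∈ W) (hv : v ∈ W) (hw : w ∈ W) :
    a (x + τ • w) (τ • v) =
      1 / 2 * a (x + τ • v) (x + τ • v) - 1 / 2 * a x x
        - τ ^ 2 / 2 * a (v - w) (v - w) + τ ^ 2 / 2 * a w w := by
  have hadd_right : ∀ u ∈ W, ∀ y ∈ W, ∀ z ∈ W, a u (y + z) = a u y + a u z :=
    fun u hu y hy z hz => by
      rw [hsymm u hu _ (W.add_mem hy hz), hadd y hy z hz u hu, hsymm y hy u hu, hsymm z hz u hu]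
  have hsmul_right : ∀ (c : ℝ), ∀ u ∈ W, ∀ y ∈ W, a u (c • y) = c * a u y :=
    fun c u hu y hy => by
      rw [hsymm u hu _ (W.smul_mem c hy), hsmul c y hy u hu, hsymm y hy u hu]
  have expand : ∀ (c : ℝ), ∀ y ∈ W, ∀ z ∈ W,
      a (y + c • z) (y + c • z) = a y y + 2 * c * a y z + c ^ 2 * a z z := fun c y hy z hz => by
    have hcz := W.smul_mem c hz
    rw [hadd y hy _ hcz _ (W.add_mem hy hcz), hadd_right y hy y hy _ hcz,
      hadd_right _ hcz y hy _ hcz, hsmul_right c y hy z hz, hsmul c z hz y hy,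
      hsmul c z hz _ hcz, hsmul_right c z hz z hz, hsymm z hz y hy]
    ring
  have hsub : v - w = v + (-1 : ℝ) • w := by rw [neg_one_smul, sub_eq_add_neg]
  rw [hsub, expand τ x hx v hv, expand (-1) v hv w hw,
    hadd x hx _ (W.smul_mem τ hw) _ (W.smul_mem τ hv), hsmul_right τ x hx v hv,
    hsmul τ w hw _ (W.smul_mem τ hv), hsmul_right τ w hw v hv, hsymm w hw v hv]
  ring

lemma real_inner_sub_left_self {E : Type*} [NormedAddCommGroup E] [InnerProductSpace ℝ E]
    (x y : E) : ⟪x - y, x⟫ = ‖x‖ ^ 2 / 2 - ‖y‖ ^ 2 / 2 + ‖x - y‖ ^ 2 / 2 := by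
  rw [norm_sub_sq_real, inner_sub_left, real_inner_self_eq_norm_sq, real_inner_comm]
  ring

lemma norm_one_div_smul_sq {E : Type*} [NormedAddCommGroup E] [NormedSpace ℝ E] (c : ℝ) (x : E) :
    ‖(1 / c) • x‖ ^ 2 = ‖x‖ ^ 2 / c ^ 2 := by
  rw [norm_smul, mul_pow, Real.norm_eq_abs, sq_abs]
  ring

/-- Conditional stability of the semi-implicit scheme without solid correction
(Algorithm 2) with second-order extrapolation `d^{m⋆} = dᵐ⁻¹ + τḋᵐ⁻¹`. -/
theorem algorithm2_conditional_stability_second_order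
    {F S : Type*}
    [NormedAddCommGroup F] [InnerProductSpace ℝ F] [CompleteSpace F]
    [NormedAddCommGroup S] [InnerProductSpace ℝ S] [CompleteSpace S]
    (Wh : Submodule ℝ S) [FiniteDimensional ℝ Wh]
    (a : S → S → ℝ)
    (hsymm : ∀ u ∈ Wh, ∀ v ∈ Wh, a u v = a v u)
    (hadd : ∀ u ∈ Wh, ∀ v ∈ Wh, ∀ w ∈ Wh, a (u + v) w = a u w + a v w)
    (hsmul : ∀ (c : ℝ), ∀ u ∈ Wh, ∀ w ∈ Wh, a (c • u) w = c * a u w)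
    (hpos : ∀ w ∈ Wh, w ≠ 0 → 0 < a w w)
    (ρf ρs ε τ : ℝ) (hρf : 0 < ρf) (hρs : 0 < ρs) (hε : 0 < ε) (hτ : 0 < τ)
    (u : ℕ → F) (d ddot : ℕ → S) (δ : ℕ → ℝ)
    (hddot_mem : ∀ m, ddot m ∈ Wh) (hd0_mem : d 0 ∈ Wh)
    (hδ : ∀ m, 1 ≤ m → 0 ≤ δ m)
    (hd : ∀ m, 1 ≤ m → d m = d (m - 1) + τ • ddot m)
    (hscheme : ∀ m, 1 ≤ m →
      ρf * ⟪u m - u (m - 1), u m⟫ + δ m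
        + ρs * ε * ⟪ddot m - ddot (m - 1), ddot m⟫
        + a (d (m - 1) + τ • ddot (m - 1)) (d m - d (m - 1)) = 0)
    (α : ℝ) (hα : 0 < α)
    (hCFL : ∀ w ∈ Wh, τ * a w w ≤ α * ‖w‖ ^ 2)
    (hτα : τ * α < ρs * ε) :
    ∀ n, 1 ≤ n →
      (ρf / 2 * ‖u n‖ ^ 2 + ρs * ε / 2 * ‖ddot n‖ ^ 2 + 1 / 2 * a (d n) (d n))
        + (∑ m ∈ Finset.Icc 1 n, δ m)
        + τ ^ 2 * ∑ m ∈ Finset.Icc 1 n,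
            (ρf / 2 * ‖(1 / τ) • (u m - u (m - 1))‖ ^ 2
              + (ρs * ε - τ * α) / 2 * ‖(1 / τ) • (ddot m - ddot (m - 1))‖ ^ 2)
      ≤ Real.exp ((n : ℝ) * τ * α / (ρs * ε - τ * α)) *
          (ρf / 2 * ‖u 0‖ ^ 2 + ρs * ε / 2 * ‖ddot 0‖ ^ 2 + 1 / 2 * a (d 0) (d 0)) := by
  have hnonneg : ∀ w ∈ Wh, 0 ≤ a w w := fun w hw => by
    rcases eq_or_ne w 0 with rfl | hne
    · simpa using (hsmul 0 0 hw 0 hw).ge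
    · exact (hpos w hw hne).le
  have hd_mem : ∀ m, d m ∈ Wh := fun m => by
    induction m with
    | zero => exact hd0_mem
    | succ k ih =>
      rw [hd (k + 1) k.succ_pos]
      exact Wh.add_mem ih (Wh.smul_mem τ (hddot_mem _))
  have energy_decay : ∀ n,
      (ρf / 2 * ‖u n‖ ^ 2 + ρs * ε / 2 * ‖ddot n‖ ^ 2 + 1 / 2 * a (d n) (d n))
        + (∑ m ∈ Finset.Icc 1 n, δ m)
        + τ ^ 2 * ∑ m ∈ Finset.Icc 1 n,
            (ρf / 2 * ‖(1 / τ) • (u m - u (m - 1))‖ ^ 2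
              + (ρs * ε - τ * α) / 2 * ‖(1 / τ) • (ddot m - ddot (m - 1))‖ ^ 2)
      ≤ ρf / 2 * ‖u 0‖ ^ 2 + ρs * ε / 2 * ‖ddot 0‖ ^ 2 + 1 / 2 * a (d 0) (d 0) := fun n => by
    induction n with
    | zero => simp
    | succ k ih =>
      rw [Finset.sum_Icc_succ_top (by lia), Finset.sum_Icc_succ_top (by lia)]
      have hbalance := hscheme (k + 1) k.succ_pos
      have hupdate := hd (k + 1) k.succ_pos
      simp only [add_tsub_cancel_right] at hbalance hupdate ⊢
      have hincr : d (k + 1) - d k = τ • ddot (k + 1) := by rw [hupdate, add_sub_cancel_left]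
      rw [hincr, extrapolated_form_eq Wh a hsymm hadd hsmul τ (hd_mem k) (hddot_mem _)
        (hddot_mem _), ← hupdate, real_inner_sub_left_self, real_inner_sub_left_self] at hbalance
      have hcfl := mul_le_mul_of_nonneg_left
        (hCFL _ (Wh.sub_mem (hddot_mem (k + 1)) (hddot_mem k))) (half_pos hτ).le
      have hprev := mul_nonneg (sq_nonneg τ) (hnonneg _ (hddot_mem k))
      have hscale : τ ^ 2 * (ρf / 2 * ‖(1 / τ) • (u (k + 1) - u k)‖ ^ 2
            + (ρs * ε - τ * α) / 2 * ‖(1 / τ) • (ddot (k + 1) - ddot k)‖ ^ 2)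
          = ρf / 2 * ‖u (k + 1) - u k‖ ^ 2
            + (ρs * ε - τ * α) / 2 * ‖ddot (k + 1) - ddot k‖ ^ 2 := by
        rw [norm_one_div_smul_sq, norm_one_div_smul_sq]
        field_simp
      rw [mul_add (τ ^ 2), hscale]
      linarith
  intro n _
  refine (energy_decay n).trans (le_mul_of_one_le_left ?_ (Real.one_le_exp ?_))
  · have := hnonneg _ hd0_mem
    positivity
  · have := sub_pos.mpr hτα
    positivity
end

section
/- Conditional stability of the semi-implicit scheme with solid correction (Algorithm 3) with extrapolation of order r = 2: Suppose (uᵐ)_{m≥0} ⊆ F, (dᵐ)_{m≥0} ⊆ W_h and ḋ⁰ ∈ W_h are given, set ḋᵐ = ∂_τ dᵐ for m ≥ 1, and suppose the nonnegative reals (δ_m)_{m≥1} are such that for every m ≥ 1 the tested scheme equation ρ_f⟨uᵐ − uᵐ⁻¹, uᵐ⟩_F + δ_m + ρ_s ε⟨ḋᵐ − ḋᵐ⁻¹, ḋ^{m−1/2}⟩_S + τ a(dᵐ, ḋ^{m−1/2}) = 0 holds, where ḋ^{m−1/2} = ḋᵐ + (τ/(ρ_s ε)) L_h(dᵐ − dᵐ⁻¹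 − τḋᵐ⁻¹) is the fractional-step solid velocity (extrapolation d^{m⋆} = dᵐ⁻¹ + τḋᵐ⁻¹). Assume there is κ > 0 with ‖w‖_s ≤ κ‖w‖_S for all w ∈ W_h (in the thesis κ = β_s^{1/2} C_I/h_s via the inverse inequality on a quasi-uniform solid mesh) and a constant α > 0 with τ⁵κ⁶ ≤ α⁵(ρ_s ε)³ and 2τα⁵ < 1. Then for every n ≥ 1: τ² Σ_{m=1}^{n} ‖ḋᵐ − ḋᵐ⁻¹‖_s² + Eⁿ + Σ_{m=1}^{n} δ_m + τ² Σ_{m=1}^{n} [(ρ_f/2)‖∂_τ uᵐ‖_F² + (ρ_s ε/4)‖∂_τ ḋᵐ‖_S² + (1/2)‖∂_τ dᵐ‖_s²] ≤ exp(2nτα⁵/(1 − 2τα⁵)) · E⁰, where Eᵐ = (ρ_f/2)‖uᵐ‖_F² + (ρ_s ε/2)‖ḋᵐ‖_S² + (1/2)‖dᵐ‖_s². -/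
open RealInnerProductSpace

section BilinForm

variable {V : Type*} [NormedAddCommGroup V] [InnerProductSpace ℝ V]
  {B : LinearMap.BilinForm ℝ V} {L : V → V} {κ : ℝ}

/-- The operator representing a bilinear form satisfying an inverse inequality with constant `κ`
is bounded by `κ ^ 3` from the Hilbert norm to the energy norm. -/
lemma energy_operator_le (hnonneg : ∀ x, 0 ≤ B x x) (hsymm : ∀ x y, B x y = B y x)
    (hL : ∀ w z, ⟪L w, z⟫ = B w z) (hinv : ∀ w, B w w ≤ κ ^ 2 * ‖w‖ ^ 2) (e : V) :
    B (L e) (L e) ≤ κ ^ 6 * ‖e‖ ^ 2 := by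
  have hnorm : ‖L e‖ ^ 2 = B e (L e) := by rw [← hL, real_inner_self_eq_norm_sq]
  have hcs : (‖L e‖ ^ 2) ^ 2 ≤ B e e * B (L e) (L e) := by
    rw [hnorm]
    exact B.apply_sq_le_of_symm hnonneg ⟨hsymm⟩ e (L e)
  have hle : ‖L e‖ ^ 2 * ‖L e‖ ^ 2 ≤ κ ^ 2 * B e e * ‖L e‖ ^ 2 := by
    nlinarith [mul_le_mul_of_nonneg_left (hinv (L e)) (hnonneg e)]
  have hbound : ‖L e‖ ^ 2 ≤ κ ^ 2 * B e e := by
    rcases (sq_nonneg ‖L e‖).eq_or_lt with h | h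
    · rw [← h]
      exact mul_nonneg (sq_nonneg κ) (hnonneg e)
    · exact le_of_mul_le_mul_right hle h
  calc B (L e) (L e) ≤ κ ^ 2 * ‖L e‖ ^ 2 := hinv _
    _ ≤ κ ^ 2 * (κ ^ 2 * (κ ^ 2 * ‖e‖ ^ 2)) := by
      gcongr
      exact hbound.trans (by gcongr; exact hinv e)
    _ = κ ^ 6 * ‖e‖ ^ 2 := by ring

/-- The extrapolation error term is absorbed, under the CFL condition, by the numerical
dissipation and the elastic energy. -/
lemma neg_extrapolation_le (hnonneg : ∀ x, 0 ≤ B x x) (hsymm : ∀ x y, B x y = B y x)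
    (hL : ∀ w z, ⟪L w, z⟫ = B w z) (hinv : ∀ w, B w w ≤ κ ^ 2 * ‖w‖ ^ 2)
    {ρ τ α : ℝ} (hρ : 0 < ρ) (hτ : 0 < τ) (hα : 0 < α)
    (hCFL : τ ^ 5 * κ ^ 6 ≤ α ^ 5 * ρ ^ 3) (d e : V) :
    -(τ ^ 3 / ρ * B d (L e)) ≤ ρ / 4 * ‖e‖ ^ 2 + τ * α ^ 5 * B d d := by
  have hd := hnonneg d
  have hcs : B d (L e) ^ 2 ≤ B d d * (κ ^ 6 * ‖e‖ ^ 2) :=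
    (B.apply_sq_le_of_symm hnonneg ⟨hsymm⟩ d (L e)).trans
      (mul_le_mul_of_nonneg_left (energy_operator_le hnonneg hsymm hL hinv e) hd)
  have hsq : (τ ^ 3 / ρ * B d (L e)) ^ 2 ≤ (ρ / 4 * ‖e‖ ^ 2 + τ * α ^ 5 * B d d) ^ 2 :=
    calc (τ ^ 3 / ρ * B d (L e)) ^ 2 = τ ^ 6 / ρ ^ 2 * B d (L e) ^ 2 := by ring
      _ ≤ τ ^ 6 / ρ ^ 2 * (B d d * (κ ^ 6 * ‖e‖ ^ 2)) := by gcongr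
      _ = τ / ρ ^ 2 * (B d d * ‖e‖ ^ 2) * (τ ^ 5 * κ ^ 6) := by ring
      _ ≤ τ / ρ ^ 2 * (B d d * ‖e‖ ^ 2) * (α ^ 5 * ρ ^ 3) := by gcongr
      _ = 4 * (ρ / 4 * ‖e‖ ^ 2) * (τ * α ^ 5 * B d d) := by field_simp
      _ ≤ (ρ / 4 * ‖e‖ ^ 2 + τ * α ^ 5 * B d d) ^ 2 := four_mul_le_sq_add _ _
  exact (neg_le_abs _).trans (abs_le_of_sq_le_sq hsq (by positivity))

/-- One-step energy inequality for the solid subproblem; `v₀`, `v` are the consecutive solid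
velocities and `d - τ • v`, `d` the consecutive displacements. -/
lemma solid_energy_step (hnonneg : ∀ x, 0 ≤ B x x) (hsymm : ∀ x y, B x y = B y x)
    (hL : ∀ w z, ⟪L w, z⟫ = B w z) (hLsmul : ∀ (c : ℝ) w, L (c • w) = c • L w)
    (hinv : ∀ w, B w w ≤ κ ^ 2 * ‖w‖ ^ 2)
    {ρ τ α : ℝ} (hρ : 0 < ρ) (hτ : 0 < τ) (hα : 0 < α)
    (hCFL : τ ^ 5 * κ ^ 6 ≤ α ^ 5 * ρ ^ 3) {d d₀ v v₀ : V} (hd : d - d₀ = τ • v) :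
    (ρ / 2 * ‖v‖ ^ 2 + 1 / 2 * B d d) + τ ^ 2 * B (v - v₀) (v - v₀)
        + ρ / 4 * ‖v - v₀‖ ^ 2 + τ ^ 2 / 2 * B v v
      ≤ (ρ / 2 * ‖v₀‖ ^ 2 + 1 / 2 * B d₀ d₀) + τ * α ^ 5 * B d d
        + (ρ * ⟪v - v₀, v + (τ / ρ) • L (d - d₀ - τ • v₀)⟫
          + τ * B d (v + (τ / ρ) • L (d - d₀ - τ • v₀))) := by
  have herr := neg_extrapolation_le hnonneg hsymm hL hinv hρ hτ hα hCFL d (v - v₀)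
  have hv : ⟪v - v₀, v⟫ = (‖v‖ ^ 2 - ‖v₀‖ ^ 2 + ‖v - v₀‖ ^ 2) / 2 := by
    rw [norm_sub_sq_real, inner_sub_left, real_inner_self_eq_norm_sq, real_inner_comm]
    ring
  have hLe : ⟪v - v₀, L (v - v₀)⟫ = B (v - v₀) (v - v₀) := by rw [real_inner_comm, hL]
  have hd₀ : B d₀ d₀ = B d d - 2 * τ * B d v + τ ^ 2 * B v v := by
    rw [show d₀ = d - τ • v by rw [← hd]; abel]
    simp only [map_sub, map_smul, LinearMap.sub_apply, LinearMap.smul_apply, smul_eq_mul,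
      hsymm v d]
    ring
  have hext : d - d₀ - τ • v₀ = τ • (v - v₀) := by rw [hd, smul_sub]
  rw [hext, hLsmul, smul_smul, inner_add_right, real_inner_smul_right, map_add, map_smul,
    smul_eq_mul, hv, hLe, hd₀]
  have hρ' : ρ * (τ / ρ * τ * B (v - v₀) (v - v₀)) = τ ^ 2 * B (v - v₀) (v - v₀) := by
    field_simp
  have hτ' : τ * (τ / ρ * τ * B d (L (v - v₀))) = τ ^ 3 / ρ * B d (L (v - v₀)) := by ring
  rw [mul_add ρ, hρ', mul_add τ, hτ']
  linarith

end BilinForm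

/-- A discrete Grönwall inequality with dissipation, for a constant implicit growth rate. -/
lemma discrete_gronwall_implicit {E D : ℕ → ℝ} {l : ℝ} (hl₀ : 0 ≤ l) (hl₁ : l < 1)
    (hE : 0 ≤ E 0) (hD : ∀ m, 1 ≤ m → 0 ≤ D m)
    (hstep : ∀ m, E (m + 1) + D (m + 1) ≤ E m + l * E (m + 1)) (n : ℕ) :
    E n + ∑ m ∈ Finset.Icc 1 n, D m ≤ Real.exp (n * (l / (1 - l))) * E 0 := by
  induction n with
  | zero => simp
  | succ n ih =>
    have h1 : 0 < 1 - l := sub_pos.2 hl₁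
    have hsum : 0 ≤ ∑ m ∈ Finset.Icc 1 (n + 1), D m :=
      Finset.sum_nonneg fun m hm => hD m (Finset.mem_Icc.1 hm).1
    set X := E (n + 1) + ∑ m ∈ Finset.Icc 1 (n + 1), D m with hX
    have hrec : (1 - l) * X ≤ E n + ∑ m ∈ Finset.Icc 1 n, D m := by
      have := mul_nonneg hl₀ hsum
      rw [Finset.sum_Icc_succ_top (by omega)] at hX this
      nlinarith [hstep n]
    have hgrow : 1 ≤ (1 - l) * Real.exp (l / (1 - l)) := by
      have := mul_le_mul_of_nonneg_left (Real.add_one_le_exp (l / (1 - l))) h1.le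
      rwa [mul_add, mul_div_cancel₀ _ h1.ne', mul_one, add_sub_cancel] at this
    refine le_of_mul_le_mul_left ?_ h1
    calc (1 - l) * X ≤ Real.exp (n * (l / (1 - l))) * E 0 := hrec.trans ih
      _ = 1 * (Real.exp (n * (l / (1 - l))) * E 0) := (one_mul _).symm
      _ ≤ (1 - l) * Real.exp (l / (1 - l)) * (Real.exp (n * (l / (1 - l))) * E 0) := by
        gcongr
      _ = (1 - l) * (Real.exp ((n + 1 : ℕ) * (l / (1 - l))) * E 0) := by
        rw [show ((n + 1 : ℕ) : ℝ) * (l / (1 - l)) = l / (1 - l) + n * (l / (1 - l)) by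
          push_cast; ring, Real.exp_add]
        ring

/-- Conditional stability of the semi-implicit scheme with solid correction
(Algorithm 3) with extrapolation of order `r = 2`
(`d^{m⋆} = dᵐ⁻¹ + τḋᵐ⁻¹`). -/
theorem algorithm3_conditional_stability_order_two
    {F S : Type*}
    [NormedAddCommGroup F] [InnerProductSpace ℝ F] [CompleteSpace F]
    [NormedAddCommGroup S] [InnerProductSpace ℝ S] [CompleteSpace S]
    (Wh : Submodule ℝ S) [FiniteDimensional ℝ Wh]
    (a : S → S → ℝ)
    (hsymm : ∀ u ∈ Wh, ∀ v ∈ Wh, a u v = a v u)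
    (hadd : ∀ u ∈ Wh, ∀ v ∈ Wh, ∀ w ∈ Wh, a (u + v) w = a u w + a v w)
    (hsmul : ∀ (c : ℝ), ∀ u ∈ Wh, ∀ w ∈ Wh, a (c • u) w = c * a u w)
    (hpos : ∀ w ∈ Wh, w ≠ 0 → 0 < a w w)
    (Lh : S → S)
    (hLh_mem : ∀ w ∈ Wh, Lh w ∈ Wh)
    (hLh : ∀ w ∈ Wh, ∀ z ∈ Wh, ⟪Lh w, z⟫ = a w z)
    (ρf ρs ε τ : ℝ) (hρf : 0 < ρf) (hρs : 0 < ρs) (hε : 0 < ε) (hτ : 0 < τ)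
    (u : ℕ → F) (d ddot : ℕ → S) (δ : ℕ → ℝ)
    (hd_mem : ∀ m, d m ∈ Wh) (hddot_mem : ∀ m, ddot m ∈ Wh)
    (hδ : ∀ m, 1 ≤ m → 0 ≤ δ m)
    (hddot : ∀ m, 1 ≤ m → ddot m = (1 / τ) • (d m - d (m - 1)))
    (hscheme : ∀ m, 1 ≤ m →
      ρf * ⟪u m - u (m - 1), u m⟫ + δ m
        + ρs * ε * ⟪ddot m - ddot (m - 1),
            ddot m + (τ / (ρs * ε)) • Lh (d m - d (m - 1) - τ • ddot (m - 1))⟫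
        + τ * a (d m)
            (ddot m + (τ / (ρs * ε)) • Lh (d m - d (m - 1) - τ • ddot (m - 1))) = 0)
    (κ : ℝ) (hκ : 0 < κ)
    (hinv : ∀ w ∈ Wh, Real.sqrt (a w w) ≤ κ * ‖w‖)
    (α : ℝ) (hα : 0 < α)
    (hCFL : τ ^ 5 * κ ^ 6 ≤ α ^ 5 * (ρs * ε) ^ 3)
    (hsmall : 2 * τ * α ^ 5 < 1) :
    ∀ n, 1 ≤ n →
      τ ^ 2 * ∑ m ∈ Finset.Icc 1 n,
          a (ddot m - ddot (m - 1)) (ddot m - ddot (m - 1))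
        + (ρf / 2 * ‖u n‖ ^ 2 + ρs * ε / 2 * ‖ddot n‖ ^ 2 + 1 / 2 * a (d n) (d n))
        + (∑ m ∈ Finset.Icc 1 n, δ m)
        + τ ^ 2 * ∑ m ∈ Finset.Icc 1 n,
            (ρf / 2 * ‖(1 / τ) • (u m - u (m - 1))‖ ^ 2
              + ρs * ε / 4 * ‖(1 / τ) • (ddot m - ddot (m - 1))‖ ^ 2
              + 1 / 2 * a ((1 / τ) • (d m - d (m - 1))) ((1 / τ) • (d m - d (m - 1))))
      ≤ Real.exp (2 * (n : ℝ) * τ * α ^ 5 / (1 - 2 * τ * α ^ 5)) *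
          (ρf / 2 * ‖u 0‖ ^ 2 + ρs * ε / 2 * ‖ddot 0‖ ^ 2 + 1 / 2 * a (d 0) (d 0)) := by
  lift d to ℕ → Wh using hd_mem
  lift ddot to ℕ → Wh using hddot_mem
  let B : LinearMap.BilinForm ℝ Wh := LinearMap.mk₂ ℝ (fun x y : Wh => a x y)
    (fun x y z => hadd x x.2 y y.2 z z.2) (fun c x y => hsmul c x x.2 y y.2)
    (fun x y z => by
      rw [hsymm x x.2 _ (y + z).2, hsymm x x.2 y y.2, hsymm x x.2 z z.2]
      exact hadd y y.2 z z.2 x x.2)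
    (fun c x y => by
      rw [hsymm x x.2 _ (c • y).2, hsymm x x.2 y y.2]
      exact hsmul c y y.2 x x.2)
  let L : Wh → Wh := fun x => ⟨Lh x, hLh_mem x x.2⟩
  have hL : ∀ w z, ⟪L w, z⟫ = B w z := fun w z => hLh w w.2 z z.2
  have hLsmul : ∀ (c : ℝ) w, L (c • w) = c • L w := fun c w =>
    ext_inner_right ℝ fun z => by
      rw [hL, real_inner_smul_left, hL, map_smul, LinearMap.smul_apply, smul_eq_mul]
  have hBsymm : ∀ x y, B x y = B y x := fun x y => hsymm x x.2 y y.2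
  have hnonneg : ∀ x, 0 ≤ B x x := fun x => by
    rcases eq_or_ne x 0 with rfl | hx
    · simp
    · exact (hpos x x.2 fun h => hx (Subtype.ext h)).le
  have hBinv : ∀ w, B w w ≤ κ ^ 2 * ‖w‖ ^ 2 := fun w => by
    rw [← mul_pow]
    exact (Real.sqrt_le_left (by positivity)).1 (hinv w w.2)
  have hρ : 0 < ρs * ε := mul_pos hρs hε
  have hdiff : ∀ m, d (m + 1) - d m = τ • ddot (m + 1) := fun m => by
    have h : (ddot (m + 1) : S) = (1 / τ) • (d (m + 1) - d (m + 1 - 1) : S) :=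
      hddot (m + 1) (by omega)
    rw [Nat.add_sub_cancel] at h
    refine Subtype.ext ?_
    rw [Submodule.coe_smul, h, smul_smul, mul_one_div_cancel hτ.ne', one_smul, Submodule.coe_sub]
  intro n _
  let E : ℕ → ℝ := fun m =>
    ρf / 2 * ‖u m‖ ^ 2 + ρs * ε / 2 * ‖ddot m‖ ^ 2 + 1 / 2 * B (d m) (d m)
  let D : ℕ → ℝ := fun m =>
    τ ^ 2 * B (ddot m - ddot (m - 1)) (ddot m - ddot (m - 1)) + δ m
      + τ ^ 2 * (ρf / 2 * ‖(1 / τ) • (u m - u (m - 1))‖ ^ 2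
        + ρs * ε / 4 * ‖(1 / τ) • (ddot m - ddot (m - 1))‖ ^ 2
        + 1 / 2 * B ((1 / τ) • (d m - d (m - 1))) ((1 / τ) • (d m - d (m - 1))))
  have hE : ∀ m, 0 ≤ E m := fun m => by
    have := hnonneg (d m)
    positivity
  have hD : ∀ m, 1 ≤ m → 0 ≤ D m := fun m hm => by
    have := hδ m hm
    have := hnonneg (ddot m - ddot (m - 1))
    have := hnonneg ((1 / τ) • (d m - d (m - 1)))
    positivity
  have hstep : ∀ m, E (m + 1) + D (m + 1) ≤ E m + 2 * τ * α ^ 5 * E (m + 1) := fun m => by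
    have hsolid := solid_energy_step hnonneg hBsymm hL hLsmul hBinv hρ hτ hα hCFL
      (v₀ := ddot m) (hdiff m)
    have htest : ρf * ⟪u (m + 1) - u m, u (m + 1)⟫ + δ (m + 1)
        + ρs * ε * ⟪ddot (m + 1) - ddot m,
            ddot (m + 1) + (τ / (ρs * ε)) • L (d (m + 1) - d m - τ • ddot m)⟫
        + τ * B (d (m + 1))
            (ddot (m + 1) + (τ / (ρs * ε)) • L (d (m + 1) - d m - τ • ddot m)) = 0 :=
      hscheme (m + 1) (by omega)
    have hu : ⟪u (m + 1) - u m, u (m + 1)⟫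
        = (‖u (m + 1)‖ ^ 2 - ‖u m‖ ^ 2 + ‖u (m + 1) - u m‖ ^ 2) / 2 := by
      rw [norm_sub_sq_real, inner_sub_left, real_inner_self_eq_norm_sq, real_inner_comm]
      ring
    rw [hu] at htest
    have hDeq : D (m + 1) = τ ^ 2 * B (ddot (m + 1) - ddot m) (ddot (m + 1) - ddot m)
        + δ (m + 1) + (ρf / 2 * ‖u (m + 1) - u m‖ ^ 2
          + ρs * ε / 4 * ‖ddot (m + 1) - ddot m‖ ^ 2
          + τ ^ 2 / 2 * B (ddot (m + 1)) (ddot (m + 1))) := by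
      simp only [D, Nat.add_sub_cancel, hdiff, smul_smul, one_div_mul_cancel hτ.ne', one_smul,
        norm_smul, mul_pow, norm_div, norm_one, Real.norm_eq_abs, div_pow, sq_abs]
      field_simp
    have hτα : 0 ≤ τ * α ^ 5 := by positivity
    have hfluid : 0 ≤ τ * α ^ 5 * (ρf * ‖u (m + 1)‖ ^ 2) := by positivity
    have hkin : 0 ≤ τ * α ^ 5 * (ρs * ε * ‖ddot (m + 1)‖ ^ 2) := by positivity
    rw [hDeq]
    simp only [E]
    linarith
  have hmain := discrete_gronwall_implicit (by positivity) hsmall (hE 0) hD hstep n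
  have hexp : (n : ℝ) * (2 * τ * α ^ 5 / (1 - 2 * τ * α ^ 5))
      = 2 * (n : ℝ) * τ * α ^ 5 / (1 - 2 * τ * α ^ 5) := by ring
  rw [hexp] at hmain
  refine le_trans (le_of_eq ?_) hmain
  change τ ^ 2 * ∑ m ∈ Finset.Icc 1 n, B (ddot m - ddot (m - 1)) (ddot m - ddot (m - 1)) + E n
      + (∑ m ∈ Finset.Icc 1 n, δ m)
      + τ ^ 2 * ∑ m ∈ Finset.Icc 1 n, (ρf / 2 * ‖(1 / τ) • (u m - u (m - 1))‖ ^ 2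
        + ρs * ε / 4 * ‖(1 / τ) • (ddot m - ddot (m - 1))‖ ^ 2
        + 1 / 2 * B ((1 / τ) • (d m - d (m - 1))) ((1 / τ) • (d m - d (m - 1)))) = _
  simp only [D, mul_add, Finset.sum_add_distrib, Finset.mul_sum]
  ring
end

section
/- Quasi-optimal error estimate for the stabilized Stokes approximation: Assume |q_h|_{s_h} ≤ C_s‖q_h‖_Q for all q_h ∈ Q_h, and assume the discrete inf-sup property: there exists α₁ > 0 such that for every (u_h, p_h) ∈ V_h×Q_h there exists a nonzero (v_h, q_h) ∈ V_h×Q_h with a(u_h,v_h) − b(v_h,p_h) + b(u_h,q_h) + s_h(p_h,q_h) ≥ α₁(‖u_h‖_V² + ‖p_h‖_Q²)^{1/2}(‖v_h‖_V² + ‖q_h‖_Q²)^{1/2}. Let f be a bounded linear functional on V, let (u,p) ∈ V×Q solve the Stokes problem a(u,v) − b(v,p) = f(v) for all v ∈ V and b(u,q) = 0 for all q ∈ Q, and let (u_h,p_h) ∈ V_h×Q_h solve the stabilized discrete problem a(u_h,v_h) − b(v_h,p_h) = f(v_h) for all v_h ∈ V_h and b(u_h,q_h) + s_h(p_h,q_h)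 = 0 for all q_h ∈ Q_h. Then there exists C > 0, depending only on the continuity constants of a and b, on α₁ and on C_s (independent of f, u, p, u_h, p_h and the subspaces), such that ‖u − u_h‖_V + ‖p − p_h‖_Q ≤ C · [ inf over v_h ∈ V_h of ‖u − v_h‖_V + inf over q_h ∈ Q_h of (‖p − q_h‖_Q + |q_h|_{s_h}) ]. -/
/-- Cauchy–Schwarz inequality for a symmetric positive-semidefinite bilinear form on a subspace. -/
theorem abs_le_sqrt_mul_sqrt_of_posSemidef {Q : Type*} [AddCommGroup Q] [Module ℝ Q]
    (S : Submodule ℝ Q) (s : Q → Q → ℝ)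
    (hsymm : ∀ q ∈ S, ∀ q' ∈ S, s q q' = s q' q)
    (hadd : ∀ q ∈ S, ∀ q' ∈ S, ∀ q'' ∈ S, s (q + q') q'' = s q q'' + s q' q'')
    (hsmul : ∀ (c : ℝ), ∀ q ∈ S, ∀ q' ∈ S, s (c • q) q' = c * s q q')
    (hnonneg : ∀ q ∈ S, 0 ≤ s q q) {x y : Q} (hx : x ∈ S) (hy : y ∈ S) :
    |s x y| ≤ Real.sqrt (s x x) * Real.sqrt (s y y) := by
  have hquad : ∀ c : ℝ, 0 ≤ s y y * (c * c) + (2 * s x y) * c + s x x := by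
    intro c
    have hcy : c • y ∈ S := S.smul_mem c hy
    have hxcy : x + c • y ∈ S := S.add_mem hx hcy
    have h := hnonneg _ hxcy
    rw [hadd _ hx _ hcy _ hxcy, hsmul c _ hy _ hxcy, hsymm _ hx _ hxcy, hsymm _ hy _ hxcy,
      hadd _ hx _ hcy _ hx, hadd _ hx _ hcy _ hy, hsmul c _ hy _ hx, hsmul c _ hy _ hy,
      hsymm _ hy _ hx] at h
    linarith
  have hdiscrim := discrim_le_zero hquad
  rw [discrim] at hdiscrim
  rw [← Real.sqrt_mul (hnonneg x hx)]
  apply Real.abs_le_sqrt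
  linarith


/-- Quasi-optimal error estimate for the stabilized Stokes finite element
approximation: `‖u − u_h‖_V + ‖p − p_h‖_Q ≤ C (inf_{v_h} ‖u − v_h‖_V
+ inf_{q_h} (‖p − q_h‖_Q + |q_h|_{s_h}))`, with `C` independent of `f`, the
solutions and the subspaces. -/
theorem stabilized_stokes_quasi_optimal_error
    {V Q : Type*}
    [NormedAddCommGroup V] [InnerProductSpace ℝ V] [CompleteSpace V]
    [NormedAddCommGroup Q] [InnerProductSpace ℝ Q] [CompleteSpace Q]
    (a : V →L[ℝ] V →L[ℝ] ℝ) (b : V →L[ℝ] Q →L[ℝ] ℝ)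
    (α₁ Cs : ℝ) (hα₁ : 0 < α₁) (hCs : 0 ≤ Cs) :
    ∃ C > 0,
      ∀ (Vh : Submodule ℝ V) (Qh : Submodule ℝ Q),
        FiniteDimensional ℝ Vh → FiniteDimensional ℝ Qh →
        ∀ s : Q → Q → ℝ,
          (∀ q ∈ Qh, ∀ q' ∈ Qh, s q q' = s q' q) →
          (∀ q ∈ Qh, ∀ q' ∈ Qh, ∀ q'' ∈ Qh, s (q + q') q'' = s q q'' + s q' q'') →
          (∀ (c : ℝ), ∀ q ∈ Qh, ∀ q' ∈ Qh, s (c • q) q' = c * s q q') →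
          (∀ q ∈ Qh, 0 ≤ s q q) →
          (∀ q ∈ Qh, Real.sqrt (s q q) ≤ Cs * ‖q‖) →
          (∀ uh ∈ Vh, ∀ ph ∈ Qh, ∃ vh ∈ Vh, ∃ qh ∈ Qh, ¬(vh = 0 ∧ qh = 0) ∧
            α₁ * Real.sqrt (‖uh‖ ^ 2 + ‖ph‖ ^ 2) *
                Real.sqrt (‖vh‖ ^ 2 + ‖qh‖ ^ 2) ≤
              a uh vh - b vh ph + b uh qh + s ph qh) →
          ∀ (f : V →L[ℝ] ℝ) (u uh : V) (p ph : Q),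
            uh ∈ Vh → ph ∈ Qh →
            (∀ v : V, a u v - b v p = f v) →
            (∀ q : Q, b u q = 0) →
            (∀ vh ∈ Vh, a uh vh - b vh ph = f vh) →
            (∀ qh ∈ Qh, b uh qh + s ph qh = 0) →
            ‖u - uh‖ + ‖p - ph‖ ≤
              C * ((⨅ vh : Vh, ‖u - (vh : V)‖) +
                   (⨅ qh : Qh, (‖p - (qh : Q)‖ + Real.sqrt (s qh qh)))) := by
  refine ⟨1 + 2 * ((‖a‖ + ‖b‖ + Cs) / α₁), by positivity, ?_⟩
  intro Vh Qh _ _ s hsymm hadd hsmul hnonneg hbound hinfsup f u uh p ph huh hph hmom hdiv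
    hmomh hdivh
  set K : ℝ := ‖a‖ + ‖b‖ + Cs with hK
  have key : ∀ (vh : Vh) (qh : Qh), ‖u - uh‖ + ‖p - ph‖ ≤
      (1 + 2 * (K / α₁)) *
        (‖u - (vh : V)‖ + (‖p - (qh : Q)‖ + Real.sqrt (s qh qh))) := by
    rintro ⟨vh, hvh⟩ ⟨qh, hqh⟩
    dsimp only
    have hr : ph - qh ∈ Qh := Qh.sub_mem hph hqh
    obtain ⟨z, hz, t, ht, hne, hle⟩ := hinfsup (uh - vh) (Vh.sub_mem huh hvh) (ph - qh) hr
    set E : ℝ := ‖u - vh‖ + (‖p - qh‖ + Real.sqrt (s qh qh)) with hE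
    set N : ℝ := Real.sqrt (‖uh - vh‖ ^ 2 + ‖ph - qh‖ ^ 2) with hN
    set M : ℝ := Real.sqrt (‖z‖ ^ 2 + ‖t‖ ^ 2) with hM
    have hMpos : 0 < M := by
      apply Real.sqrt_pos.mpr
      by_cases hz0 : z = 0
      · have ht0 : t ≠ 0 := fun h => hne ⟨hz0, h⟩
        have := norm_pos_iff.mpr ht0
        positivity
      · have := norm_pos_iff.mpr hz0
        positivity
    have hzM : ‖z‖ ≤ M := Real.le_sqrt_of_sq_le (by nlinarith [sq_nonneg ‖t‖])
    have htM : ‖t‖ ≤ M := Real.le_sqrt_of_sq_le (by nlinarith [sq_nonneg ‖z‖])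
    have hwN : ‖uh - vh‖ ≤ N := Real.le_sqrt_of_sq_le (by nlinarith [sq_nonneg ‖ph - qh‖])
    have hrN : ‖ph - qh‖ ≤ N := Real.le_sqrt_of_sq_le (by nlinarith [sq_nonneg ‖uh - vh‖])
    have hs : s ph t = s (ph - qh) t + s qh t := by
      rw [← hadd _ hr _ hqh _ ht, sub_add_cancel]
    have hresidual : a (uh - vh) z - b z (ph - qh) + b (uh - vh) t + s (ph - qh) t =
        a (u - vh) z - b z (p - qh) + b (u - vh) t - s qh t := by
      have h1 := hmom z
      have h2 := hmomh z hz
      have h3 := hdiv t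
      have h4 := hdivh t ht
      simp only [map_sub, sub_apply]
      linarith
    have ha : a (u - vh) z ≤ ‖a‖ * ‖u - vh‖ * M :=
      (le_abs_self _).trans ((a.le_opNorm₂ _ _).trans (by gcongr))
    have hbz : -b z (p - qh) ≤ ‖b‖ * M * ‖p - qh‖ :=
      (neg_le_abs _).trans ((b.le_opNorm₂ _ _).trans (by gcongr))
    have hbt : b (u - vh) t ≤ ‖b‖ * ‖u - vh‖ * M :=
      (le_abs_self _).trans ((b.le_opNorm₂ _ _).trans (by gcongr))
    have hst : -s qh t ≤ Real.sqrt (s qh qh) * (Cs * M) :=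
      (neg_le_abs _).trans
        ((abs_le_sqrt_mul_sqrt_of_posSemidef Qh s hsymm hadd hsmul hnonneg hqh ht).trans
          (by gcongr; exact (hbound t ht).trans (by gcongr)))
    have hKE : ‖a‖ * ‖u - vh‖ + ‖b‖ * ‖p - qh‖ + ‖b‖ * ‖u - vh‖ + Cs * Real.sqrt (s qh qh) ≤
        K * E := by
      have : 0 ≤ ‖a‖ * (‖p - qh‖ + Real.sqrt (s qh qh)) + ‖b‖ * Real.sqrt (s qh qh) +
          Cs * (‖u - vh‖ + ‖p - qh‖) := by positivity
      rw [hK, hE]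
      linarith
    have hNE : N ≤ K / α₁ * E := by
      have hNM : α₁ * N * M ≤ K * E * M := by
        have := mul_le_mul_of_nonneg_right hKE hMpos.le
        linarith
      rw [div_mul_eq_mul_div, le_div_iff₀ hα₁, mul_comm N]
      exact le_of_mul_le_mul_right hNM hMpos
    have hu : ‖u - uh‖ ≤ ‖u - vh‖ + ‖uh - vh‖ := by
      simpa only [norm_sub_rev uh vh] using norm_sub_le_norm_sub_add_norm_sub u vh uh
    have hp : ‖p - ph‖ ≤ ‖p - qh‖ + ‖ph - qh‖ := by
      simpa only [norm_sub_rev ph qh] using norm_sub_le_norm_sub_add_norm_sub p qh ph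
    have hsqrt := Real.sqrt_nonneg (s qh qh)
    linarith
  have hC : 0 < 1 + 2 * (K / α₁) := by positivity
  rw [← div_le_iff₀' hC, ← sub_le_iff_le_add]
  refine le_ciInf fun vh => ?_
  rw [sub_le_comm]
  refine le_ciInf fun qh => ?_
  rw [sub_le_iff_le_add', div_le_iff₀' hC]
  exact key vh qh
end

section
/- Transport theorem: Let φ : ℝ^d × [0,T] → ℝ^d be twice continuously differentiable, with each map φ_t = φ(·,t) a diffeomorphism onto its image satisfying det(D_s φ_t(s)) > 0 for all s, and let the associated Eulerian velocity field v be continuously differentiable. Let ρ and f be continuously differentiable real-valued functions on ℝ^d × [0,T], and assume the continuity equation ∂_t ρ + div_x(ρ v) = 0 holds on the moving region. Then for every bounded open set ω ⊆ ℝ^d and every t ∈ (0,T), the function t ↦ ∫_{φ_t(ω)} ρ(x,t) f(x,t) dx is differentiable and d/dt ∫_{φ_t(ω)} ρ f dx = ∫_{φ_t(ω)} ρ · (∂_t f + v·∇_x f) dx. -/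
open MeasureTheory RealInnerProductSpace

section Determinant

variable {E : Type*} [NormedAddCommGroup E] [NormedSpace ℝ E] [FiniteDimensional ℝ E]

lemma differentiable_continuousLinearMap_det :
    Differentiable ℝ (fun A : E →L[ℝ] E => A.det) := by
  classical
  let b := Module.finBasis ℝ E
  have hdet : (fun A : E →L[ℝ] E => A.det) =
      fun A : E →L[ℝ] E => (LinearMap.toMatrix b b (A : E →ₗ[ℝ] E)).det := by
    funext A
    rw [LinearMap.det_toMatrix, ContinuousLinearMap.det]
  rw [hdet]
  simp only [Matrix.det_apply]
  refine Differentiable.fun_sum fun σ _ => Differentiable.const_smul ?_ _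
  intro A
  have hentry : ∀ i j, DifferentiableAt ℝ
      (fun C : E →L[ℝ] E => LinearMap.toMatrix b b (C : E →ₗ[ℝ] E) i j) A := by
    intro i j
    have hcoord : (fun C : E →L[ℝ] E => LinearMap.toMatrix b b (C : E →ₗ[ℝ] E) i j) =
        fun C : E →L[ℝ] E => LinearMap.toContinuousLinearMap (b.coord i) (C (b j)) := by
      funext C
      simp [LinearMap.toMatrix_apply]
    rw [hcoord]
    fun_prop
  exact (HasFDerivAt.finsetProd fun i _ => (hentry (σ i) i).hasFDerivAt).differentiableAt

lemma hasDerivAt_det_one_add_smul (B : E →L[ℝ] E) :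
    HasDerivAt (fun r : ℝ => (1 + r • B).det) (LinearMap.trace ℝ E B.toLinearMap) 0 := by
  classical
  let b := Module.finBasis ℝ E
  let M := LinearMap.toMatrix b b (B : E →ₗ[ℝ] E)
  have hdet : (fun r : ℝ => (1 + r • B).det) = fun r : ℝ => (1 + r • M).det := by
    funext r
    rw [ContinuousLinearMap.det, ← LinearMap.det_toMatrix b]
    congr 1
    simp [M, LinearMap.toMatrix_one]
  rw [hdet, LinearMap.trace_eq_matrix_trace ℝ b]
  have hexpand : (fun r : ℝ => (1 + r • M).det) = fun r : ℝ => 1 + M.trace * r +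
      (1 + (Polynomial.X : Polynomial ℝ) • M.map Polynomial.C).det.divX.divX.eval r * r ^ 2 :=
    funext fun r => Matrix.det_one_add_smul r M
  rw [hexpand]
  have hrem : HasDerivAt (fun r : ℝ => (1 + (Polynomial.X : Polynomial ℝ) •
      M.map Polynomial.C).det.divX.divX.eval r * r ^ 2) 0 0 :=
    ((Polynomial.hasDerivAt (1 + (Polynomial.X : Polynomial ℝ) •
      M.map Polynomial.C).det.divX.divX 0).mul (hasDerivAt_pow 2 0)).congr_deriv (by simp)
  exact (((hasDerivAt_id (0 : ℝ)).const_mul M.trace).const_add 1 |>.add hrem).congr_deriv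
    (by simp [M])

/-- **Jacobi's formula** along a solution of the linear equation `A' = B A`. -/
lemma HasDerivAt.continuousLinearMap_det {A : ℝ → E →L[ℝ] E} {B : E →L[ℝ] E} {t : ℝ}
    (hA : HasDerivAt A (B ∘L A t) t) :
    HasDerivAt (fun τ => (A τ).det) (LinearMap.trace ℝ E B.toLinearMap * (A t).det) t := by
  have hD := (differentiable_continuousLinearMap_det (A t)).hasFDerivAt
  have hline : HasDerivAt (fun r : ℝ => A t + r • (B ∘L A t)) (B ∘L A t) 0 := by
    simpa using ((hasDerivAt_id (0 : ℝ)).smul_const (B ∘L A t)).const_add (A t)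
  have hcurve := HasFDerivAt.comp_hasDerivAt_of_eq (0 : ℝ) hD hline (by simp)
  have hfactor : ((fun C : E →L[ℝ] E => C.det) ∘ fun r : ℝ => A t + r • (B ∘L A t)) =
      fun r : ℝ => (1 + r • B).det * (A t).det := by
    funext r
    simp only [Function.comp_apply, ContinuousLinearMap.det]
    rw [← LinearMap.det_comp]
    congr 1
  rw [hfactor] at hcurve
  rw [← hcurve.unique ((hasDerivAt_det_one_add_smul B).mul_const _)]
  exact hD.comp_hasDerivAt t hA

end Determinant

section Motion

variable {E F : Type*} [NormedAddCommGroup E] [NormedSpace ℝ E]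
  [NormedAddCommGroup F] [NormedSpace ℝ F]

lemma fderiv_uncurry_apply {g : E → ℝ → F}
    (hg : Differentiable ℝ (fun p : E × ℝ => g p.1 p.2)) (x w : E) (t : ℝ) :
    fderiv ℝ (fun p : E × ℝ => g p.1 p.2) (x, t) (w, 1) =
      deriv (g x) t + fderiv ℝ (fun y => g y t) x w := by
  have h := (hg (x, t)).hasFDerivAt
  have h₁ : HasDerivAt (g x) (fderiv ℝ (fun p : E × ℝ => g p.1 p.2) (x, t) (0, 1)) t :=
    h.comp_hasDerivAt t ((hasDerivAt_const t x).prodMk (hasDerivAt_id t))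
  have h₂ : HasFDerivAt (fun y => g y t) _ x :=
    h.comp (f := fun y => (y, t)) x ((hasFDerivAt_id x).prodMk (hasFDerivAt_const t x))
  rw [h₁.deriv, h₂.fderiv]
  simp [← map_add]

lemma hasDerivAt_along_motion {g : E → ℝ → F} {c : ℝ → E} {w : E} {t : ℝ}
    (hg : Differentiable ℝ (fun p : E × ℝ => g p.1 p.2)) (hc : HasDerivAt c w t) :
    HasDerivAt (fun τ => g (c τ) τ)
      (fderiv ℝ (fun p : E × ℝ => g p.1 p.2) (c t, t) (w, 1)) t :=
  (hg (c t, t)).hasFDerivAt.comp_hasDerivAt (f := fun τ => (c τ, τ)) t (hc.prodMk (hasDerivAt_id t))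

lemma fderiv_motion_eq {φ : ℝ → E → F}
    (hφ : Differentiable ℝ (fun p : ℝ × E => φ p.1 p.2)) (t : ℝ) (s : E) :
    fderiv ℝ (φ t) s =
      fderiv ℝ (fun p : ℝ × E => φ p.1 p.2) (t, s) ∘L ContinuousLinearMap.inr ℝ ℝ E :=
  ((hφ (t, s)).hasFDerivAt.comp s
    ((hasFDerivAt_const t s).prodMk (hasFDerivAt_id s))).fderiv

lemma continuous_fderiv_motion {φ : ℝ → E → F}
    (hφ : ContDiff ℝ 2 (fun p : ℝ × E => φ p.1 p.2)) :
    Continuous (fun p : ℝ × E => fderiv ℝ (φ p.1) p.2) := by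
  simp only [fderiv_motion_eq (hφ.differentiable two_ne_zero)]
  exact (hφ.continuous_fderiv two_ne_zero).clm_comp continuous_const

/-- The deformation gradient satisfies the equation of variation `∂_t Dφ = Dv Dφ`. -/
lemma hasDerivAt_fderiv_motion {φ : ℝ → E → E} {v : E → ℝ → E} {t : ℝ}
    (hφ : ContDiff ℝ 2 (fun p : ℝ × E => φ p.1 p.2))
    (hvel : ∀ s, HasDerivAt (fun τ => φ τ s) (v (φ t s) t) t)
    (hv : Differentiable ℝ (fun y => v y t)) (s : E) :
    HasDerivAt (fun τ => fderiv ℝ (φ τ) s)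
      (fderiv ℝ (fun y => v y t) (φ t s) ∘L fderiv ℝ (φ t) s) t := by
  have hdiff := hφ.differentiable two_ne_zero
  set Φ : ℝ × E → E := fun p => φ p.1 p.2
  have hD : HasFDerivAt (fderiv ℝ Φ) (fderiv ℝ (fderiv ℝ Φ) (t, s)) (t, s) :=
    ((hφ.fderiv_right (m := 1) (by norm_num)).differentiable one_ne_zero (t, s)).hasFDerivAt
  have htime : HasDerivAt (fun τ => fderiv ℝ Φ (τ, s))
      (fderiv ℝ (fderiv ℝ Φ) (t, s) (1, 0)) t :=
    hD.comp_hasDerivAt t ((hasDerivAt_id t).prodMk (hasDerivAt_const t s))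
  have hspace : HasFDerivAt (fun y => fderiv ℝ Φ (t, y))
      (fderiv ℝ (fderiv ℝ Φ) (t, s) ∘L ContinuousLinearMap.inr ℝ ℝ E) s :=
    hD.comp s ((hasFDerivAt_const t s).prodMk (hasFDerivAt_id s))
  have hvelocity : (fun y => fderiv ℝ Φ (t, y) (1, 0)) = fun y => v (φ t y) t := by
    funext y
    have h : HasDerivAt (fun τ => φ τ y) (fderiv ℝ Φ (t, y) (1, 0)) t :=
      (hdiff (t, y)).hasFDerivAt.comp_hasDerivAt (f := fun τ => (τ, y)) t
        ((hasDerivAt_id t).prodMk (hasDerivAt_const t y))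
    exact h.unique (hvel y)
  have hφt : DifferentiableAt ℝ (φ t) s :=
    ((hdiff (t, s)).hasFDerivAt.comp s
      ((hasFDerivAt_const t s).prodMk (hasFDerivAt_id s))).differentiableAt
  have hmixed := hspace.clm_apply (hasFDerivAt_const ((1, 0) : ℝ × E) s)
  rw [hvelocity] at hmixed
  have hchain : HasFDerivAt (fun y => v (φ t y) t) _ s :=
    (hv (φ t s)).hasFDerivAt.comp s hφt.hasFDerivAt
  have hsymm : IsSymmSndFDerivAt ℝ Φ (t, s) :=
    hφ.contDiffAt.isSymmSndFDerivAt (by simp)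
  have key : fderiv ℝ (fun y => v y t) (φ t s) ∘L fderiv ℝ (φ t) s =
      fderiv ℝ (fderiv ℝ Φ) (t, s) (1, 0) ∘L ContinuousLinearMap.inr ℝ ℝ E := by
    rw [hchain.unique hmixed]
    ext w
    simpa using hsymm.eq (0, w) (1, 0)
  rw [key]
  simp only [fderiv_motion_eq hdiff]
  have hcomp := htime.clm_comp
    (hasDerivAt_const t (ContinuousLinearMap.inr ℝ ℝ E))
  simpa using hcomp

lemma trace_fderiv_smul {r : E → ℝ} {w : E → E} {x : E} [FiniteDimensional ℝ E]
    (hr : DifferentiableAt ℝ r x) (hw : DifferentiableAt ℝ w x) :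
    LinearMap.trace ℝ E (fderiv ℝ (fun y => r y • w y) x).toLinearMap =
      r x * LinearMap.trace ℝ E (fderiv ℝ w x).toLinearMap + fderiv ℝ r x (w x) := by
  rw [fderiv_fun_smul hr hw]
  have : ((r x • fderiv ℝ w x + (fderiv ℝ r x).smulRight (w x) : E →L[ℝ] E) : E →ₗ[ℝ] E) =
      r x • (fderiv ℝ w x).toLinearMap + (fderiv ℝ r x).toLinearMap.smulRight (w x) := rfl
  rw [this, map_add, map_smul, LinearMap.trace_smulRight]
  simp

end Motion

/-- Differentiation under the integral sign over a bounded set, for a jointly continuous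
derivative. -/
lemma hasDerivAt_setIntegral_of_continuous {E : Type*} [NormedAddCommGroup E]
    [ProperSpace E] [MeasurableSpace E] [BorelSpace E] {μ : Measure E} [IsFiniteMeasureOnCompacts μ] {F F' : ℝ → E → ℝ} {ω : Set E} {U : Set ℝ}
    {t : ℝ} (hω : Bornology.IsBounded ω) (hU : U ∈ nhds t)
    (hF : Continuous (fun p : ℝ × E => F p.1 p.2))
    (hF' : Continuous (fun p : ℝ × E => F' p.1 p.2))
    (hderiv : ∀ τ ∈ U, ∀ s, HasDerivAt (fun τ' => F τ' s) (F' τ s) τ) :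
    HasDerivAt (fun τ => ∫ s in ω, F τ s ∂μ) (∫ s in ω, F' t s ∂μ) t := by
  obtain ⟨K, hK, hKU, hKc⟩ := local_compact_nhds hU
  have hωc : IsCompact (closure ω) := hω.isCompact_closure
  obtain ⟨C, hC⟩ := (hKc.prod hωc).exists_bound_of_continuousOn hF'.continuousOn
  have hslice : ∀ {G : ℝ → E → ℝ}, Continuous (fun p : ℝ × E => G p.1 p.2) →
      ∀ τ, Continuous (G τ) := fun hG τ => hG.comp (Continuous.prodMk_right τ)
  have hint : ∀ {g : E → ℝ}, Continuous g → IntegrableOn g ω μ := fun hg =>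
    (hg.continuousOn.integrableOn_compact hωc).mono_set subset_closure
  have hmem : ∀ᵐ s ∂μ.restrict ω, s ∈ closure ω :=
    ae_restrict_of_ae_restrict_of_subset subset_closure
      (ae_restrict_mem isClosed_closure.measurableSet)
  refine (hasDerivAt_integral_of_dominated_loc_of_deriv_le (bound := fun _ => C) hK
    (Filter.Eventually.of_forall fun τ => (hint (hslice hF τ)).aestronglyMeasurable)
    (hint (hslice hF t)) (hint (hslice hF' t)).aestronglyMeasurable ?_
    (hint continuous_const) ?_).2
  · filter_upwards [hmem] with s hs τ hτ using hC (τ, s) ⟨hτ, hs⟩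
  · exact Filter.Eventually.of_forall fun s τ hτ => hderiv τ (hKU hτ) s

/-- Transport theorem: if the continuity equation `∂_t ρ + div_x(ρv) = 0`
holds along the motion, then
`d/dt ∫_{φ_t(ω)} ρ f dx = ∫_{φ_t(ω)} ρ (∂_t f + v·∇_x f) dx`. -/
theorem transport_theorem
    {d : ℕ} (T : ℝ) (hT : 0 < T)
    (φ : ℝ → EuclideanSpace ℝ (Fin d) → EuclideanSpace ℝ (Fin d))
    (v : EuclideanSpace ℝ (Fin d) → ℝ → EuclideanSpace ℝ (Fin d))
    (ρ f : EuclideanSpace ℝ (Fin d) → ℝ → ℝ)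
    (hφ : ContDiff ℝ 2 (fun p : ℝ × EuclideanSpace ℝ (Fin d) => φ p.1 p.2))
    (hφinj : ∀ t ∈ Set.Icc (0 : ℝ) T, Function.Injective (φ t))
    (hφdet : ∀ t ∈ Set.Icc (0 : ℝ) T, ∀ s : EuclideanSpace ℝ (Fin d),
      0 < LinearMap.det (fderiv ℝ (φ t) s).toLinearMap)
    (hvel : ∀ s : EuclideanSpace ℝ (Fin d), ∀ t ∈ Set.Icc (0 : ℝ) T,
      HasDerivAt (fun t' => φ t' s) (v (φ t s) t) t)
    (hv : ContDiff ℝ 1 (fun p : EuclideanSpace ℝ (Fin d) × ℝ => v p.1 p.2))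
    (hρ : ContDiff ℝ 1 (fun p : EuclideanSpace ℝ (Fin d) × ℝ => ρ p.1 p.2))
    (hf : ContDiff ℝ 1 (fun p : EuclideanSpace ℝ (Fin d) × ℝ => f p.1 p.2))
    (hcont : ∀ t ∈ Set.Icc (0 : ℝ) T, ∀ s : EuclideanSpace ℝ (Fin d),
      deriv (ρ (φ t s)) t
        + LinearMap.trace ℝ (EuclideanSpace ℝ (Fin d))
            (fderiv ℝ (fun y => ρ y t • v y t) (φ t s)).toLinearMap = 0) :
    ∀ ω : Set (EuclideanSpace ℝ (Fin d)), IsOpen ω → Bornology.IsBounded ω →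
      ∀ t ∈ Set.Ioo (0 : ℝ) T,
        HasDerivAt (fun t' => ∫ x in φ t' '' ω, ρ x t' * f x t')
          (∫ x in φ t '' ω,
            ρ x t * (deriv (f x) t + ⟪v x t, gradient (fun y => f y t) x⟫)) t := by
  intro ω hω hωb t ht
  have hφ1 : Differentiable ℝ (fun p : ℝ × EuclideanSpace ℝ (Fin d) => φ p.1 p.2) :=
    hφ.differentiable two_ne_zero
  have hρ1 := hρ.differentiable one_ne_zero
  have hf1 := hf.differentiable one_ne_zero
  have hv1 := hv.differentiable one_ne_zero
  have hspace : ∀ τ : ℝ, Differentiable ℝ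
      (fun y : EuclideanSpace ℝ (Fin d) => ((y, τ) : EuclideanSpace ℝ (Fin d) × ℝ)) :=
    fun τ => by fun_prop
  have hφt : ∀ τ, Differentiable ℝ (φ τ) := fun τ =>
    hφ1.comp (f := fun y => (τ, y)) (by fun_prop)
  have hvt : ∀ τ, Differentiable ℝ (fun y => v y τ) := fun τ => hv1.comp (hspace τ)
  have hρt : ∀ τ, Differentiable ℝ (fun y => ρ y τ) := fun τ => hρ1.comp (hspace τ)
  let Mf : EuclideanSpace ℝ (Fin d) → ℝ → ℝ := fun x τ =>
    fderiv ℝ (fun p : EuclideanSpace ℝ (Fin d) × ℝ => f p.1 p.2) (x, τ) (v x τ, 1)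
  have hMf : ∀ x τ, deriv (f x) τ + ⟪v x τ, gradient (fun y => f y τ) x⟫ = Mf x τ := by
    intro x τ
    rw [real_inner_comm, inner_gradient_left]
    exact (fderiv_uncurry_apply hf1 x (v x τ) τ).symm
  have hchange : ∀ τ ∈ Set.Icc (0 : ℝ) T, ∀ g : EuclideanSpace ℝ (Fin d) → ℝ,
      ∫ x in φ τ '' ω, g x = ∫ s in ω, (fderiv ℝ (φ τ) s).det * g (φ τ s) := by
    intro τ hτ g
    rw [integral_image_eq_integral_abs_det_fderiv_smul volume hω.measurableSet
      (fun s _ => (hφt τ s).hasFDerivAt.hasFDerivWithinAt) (hφinj τ hτ).injOn]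
    refine integral_congr_ae (Filter.Eventually.of_forall fun s => ?_)
    change |(fderiv ℝ (φ τ) s).det| • g (φ τ s) = _
    rw [abs_of_pos (hφdet τ hτ s), smul_eq_mul]
  have hJ : Continuous (fun p : ℝ × EuclideanSpace ℝ (Fin d) =>
      (fderiv ℝ (φ p.1) p.2).det) :=
    ContinuousLinearMap.continuous_det.comp (continuous_fderiv_motion hφ)
  have hpull : ∀ {g : EuclideanSpace ℝ (Fin d) → ℝ → ℝ},
      Continuous (fun p : EuclideanSpace ℝ (Fin d) × ℝ => g p.1 p.2) →
      Continuous (fun p : ℝ × EuclideanSpace ℝ (Fin d) => g (φ p.1 p.2) p.1) :=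
    fun hg => hg.comp (hφ.continuous.prodMk continuous_fst)
  have hMfc : Continuous (fun p : EuclideanSpace ℝ (Fin d) × ℝ => Mf p.1 p.2) :=
    (hf.continuous_fderiv one_ne_zero).clm_apply (hv.continuous.prodMk continuous_const)
  have hderiv : ∀ τ ∈ Set.Ioo (0 : ℝ) T, ∀ s, HasDerivAt
      (fun τ' => (fderiv ℝ (φ τ') s).det * (ρ (φ τ' s) τ' * f (φ τ' s) τ'))
      ((fderiv ℝ (φ τ) s).det * (ρ (φ τ s) τ * Mf (φ τ s) τ)) τ := by
    intro τ hτ s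
    have hτ' := Set.Ioo_subset_Icc_self hτ
    have hdet := (hasDerivAt_fderiv_motion hφ (fun y => hvel y τ hτ') (hvt τ)
      s).continuousLinearMap_det
    have hρ' := hasDerivAt_along_motion hρ1 (hvel s τ hτ')
    have hf' : HasDerivAt (fun τ' => f (φ τ' s) τ') (Mf (φ τ s) τ) τ :=
      hasDerivAt_along_motion hf1 (hvel s τ hτ')
    rw [fderiv_uncurry_apply hρ1] at hρ'
    have hc := hcont τ hτ' s
    rw [trace_fderiv_smul (hρt τ _) (hvt τ _)] at hc
    refine (hdet.mul (hρ'.mul hf')).congr_deriv ?_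
    simp only [Pi.mul_apply]
    linear_combination (fderiv ℝ (φ τ) s).det * f (φ τ s) τ * hc
  have hmain := hasDerivAt_setIntegral_of_continuous (μ := volume) hωb
    (isOpen_Ioo.mem_nhds ht)
    (hJ.mul ((hpull hρ.continuous).mul (hpull hf.continuous)))
    (hJ.mul ((hpull hρ.continuous).mul (hpull hMfc))) hderiv
  simp only [hMf]
  rw [hchange t (Set.Ioo_subset_Icc_self ht)]
  refine hmain.congr_of_eventuallyEq ?_
  filter_upwards [isOpen_Ioo.mem_nhds ht] with τ hτ
  exact hchange τ (Set.Ioo_subset_Icc_self hτ) _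
end

section
/- Piola identity: Let φ : ℝ^d → ℝ^d be twice continuously differentiable and let F(s) = Dφ(s) be its Jacobian matrix. Then the cofactor matrix cof F(s) (the transpose of the adjugate of F(s), which equals det(F(s))·F(s)^{−T} whenever F(s) is invertible) is row-wise divergence free: for every index i ∈ {1,…,d} and every s ∈ ℝ^d, Σ_{j=1}^{d} ∂/∂s_j [ (cof F(s))_{ij} ] = 0. In particular, if det F(s) ≠ 0 for all s, then Div(det(F) F^{−T}) = 0, where Div acts row-wise. -/
open Matrix

/-- The Jacobian matrix `F(s)_{ij} = ∂φ_i/∂s_j` of a map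
`φ : ℝ^d → ℝ^d`. -/
noncomputable def jacobianMatrix {d : ℕ}
    (φ : EuclideanSpace ℝ (Fin d) → EuclideanSpace ℝ (Fin d))
    (x : EuclideanSpace ℝ (Fin d)) : Matrix (Fin d) (Fin d) ℝ :=
  Matrix.of fun i j => fderiv ℝ φ x (EuclideanSpace.single j 1) i

/-- Exchanging the vectors placed in two distinct rows of a matrix negates the determinant. -/
theorem Matrix.det_updateRow_updateRow_swap {n R : Type*} [Fintype n] [DecidableEq n] [CommRing R]
    (A : Matrix n n R) {i k : n} (hik : i ≠ k) (u v : n → R) :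
    ((A.updateRow i u).updateRow k v).det = -((A.updateRow i v).updateRow k u).det := by
  have h := (detRowAlternating : (n → R) [⋀^n]→ₗ[R] R).map_swap
    ((A.updateRow i v).updateRow k u) hik
  refine Eq.trans (congrArg Matrix.det ?_) h
  ext a b
  change _ = (A.updateRow i v).updateRow k u (Equiv.swap i k a) b
  clear h
  by_cases hi : a = i <;> by_cases hk : a = k <;>
    simp_all [Matrix.updateRow_apply, Equiv.swap_apply_of_ne_of_ne]

theorem Matrix.det_updateRow_eq_sum {n R : Type*} [Fintype n] [DecidableEq n] [CommRing R]
    (A : Matrix n n R) (k : n) (v : n → R) :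
    (A.updateRow k v).det = ∑ l, v l * (A.updateRow k (Pi.single l 1)).det := by
  rw [← cramer_transpose_apply, cramer_eq_adjugate_mulVec, ← adjugate_transpose]
  simp [mulVec, dotProduct, adjugate_apply, mul_comm]

/-- Contracting two rows of a determinant with a symmetric matrix gives zero. -/
theorem Matrix.IsSymm.sum_det_updateRow_single_updateRow_eq_zero {n : Type*} [Fintype n]
    [DecidableEq n] {H : Matrix n n ℝ} (hH : H.IsSymm) (A : Matrix n n ℝ) {i k : n} (hik : i ≠ k) :
    ∑ j, ((A.updateRow i (Pi.single j 1)).updateRow k (H j)).det = 0 := by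
  rw [← self_eq_neg]
  simp_rw [Matrix.det_updateRow_eq_sum _ k (H _)]
  rw [← Finset.sum_neg_distrib]
  simp_rw [← Finset.sum_neg_distrib]
  conv_lhs => rw [Finset.sum_comm]
  refine Finset.sum_congr rfl fun j _ => Finset.sum_congr rfl fun l _ => ?_
  rw [A.det_updateRow_updateRow_swap hik, hH.apply, mul_neg]

/-- Jacobi's formula, in terms of the derivatives of the rows. -/
theorem fderiv_matrix_det_apply {n E : Type*} [Fintype n] [DecidableEq n]
    [NormedAddCommGroup E] [NormedSpace ℝ E] {M : E → Matrix n n ℝ} {x : E}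
    (hM : ∀ i, DifferentiableAt ℝ (fun y => M y i) x) (v : E) :
    fderiv ℝ (fun y => (M y).det) x v =
      ∑ k, ((M x).updateRow k (fderiv ℝ (fun y => M y k) x v)).det := by
  let f : ContinuousMultilinearMap ℝ (fun _ : n => n → ℝ) ℝ :=
    { (detRowAlternating : (n → ℝ) [⋀^n]→ₗ[ℝ] ℝ).toMultilinearMap with
      cont := Continuous.matrix_det (A := fun M : n → n → ℝ => of M) continuous_id }
  have h := HasFDerivAt.multilinear_comp f fun i => (hM i).hasFDerivAt
  have h' : fderiv ℝ (fun y => (M y).det) x = _ := h.fderiv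
  rw [h', _root_.sum_apply]
  rfl

section Piola

variable {d : ℕ} {φ : EuclideanSpace ℝ (Fin d) → EuclideanSpace ℝ (Fin d)}

theorem hasFDerivAt_jacobianMatrix_row (hφ : ContDiff ℝ 2 φ) (k : Fin d)
    (s : EuclideanSpace ℝ (Fin d)) :
    HasFDerivAt (fun x => jacobianMatrix φ x k)
      (ContinuousLinearMap.pi fun l => EuclideanSpace.proj k ∘L
        (fderiv ℝ (fderiv ℝ φ) s).flip (EuclideanSpace.single l 1)) s := by
  have h : HasFDerivAt (fderiv ℝ φ) (fderiv ℝ (fderiv ℝ φ) s) s :=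
    ((hφ.fderiv_right (m := 1) le_rfl).differentiable one_ne_zero s).hasFDerivAt
  refine hasFDerivAt_pi.2 fun l => ?_
  convert! (EuclideanSpace.proj (𝕜 := ℝ) k).hasFDerivAt.comp s
    (h.clm_apply (hasFDerivAt_const (EuclideanSpace.single l (1 : ℝ)) s)) using 1
  ext v
  simp

theorem fderiv_jacobianMatrix_row_apply (hφ : ContDiff ℝ 2 φ) (k l : Fin d)
    (s v : EuclideanSpace ℝ (Fin d)) :
    fderiv ℝ (fun x => jacobianMatrix φ x k) s v l =
      fderiv ℝ (fderiv ℝ φ) s v (EuclideanSpace.single l 1) k := by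
  rw [(hasFDerivAt_jacobianMatrix_row hφ k s).fderiv]
  rfl

theorem isSymm_fderiv_jacobianMatrix_row (hφ : ContDiff ℝ 2 φ) (k : Fin d)
    (s : EuclideanSpace ℝ (Fin d)) :
    (of fun j => fderiv ℝ (fun x => jacobianMatrix φ x k) s (EuclideanSpace.single j 1)).IsSymm := by
  refine IsSymm.ext fun j l => ?_
  simp only [of_apply, fderiv_jacobianMatrix_row_apply hφ]
  rw [(hφ.contDiffAt.isSymmSndFDerivAt (by simp)).eq]

theorem sum_fderiv_adjugate_jacobianMatrix_eq_zero (hφ : ContDiff ℝ 2 φ) (i : Fin d)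
    (s : EuclideanSpace ℝ (Fin d)) :
    ∑ j, fderiv ℝ (fun x => (jacobianMatrix φ x).adjugate j i) s
      (EuclideanSpace.single j 1) = 0 := by
  have hrow (j k : Fin d) (hk : k ≠ i) :
      (fun x => (jacobianMatrix φ x).updateRow i (Pi.single j 1) k) =
        fun x => jacobianMatrix φ x k := funext fun x => updateRow_ne hk
  have hrow_self (j : Fin d) :
      (fun x => (jacobianMatrix φ x).updateRow i (Pi.single j 1) i) =
        fun _ => Pi.single j 1 := funext fun x => updateRow_self
  have hdiff (j k : Fin d) : DifferentiableAt ℝ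
      (fun x => (jacobianMatrix φ x).updateRow i (Pi.single j 1) k) s := by
    by_cases hk : k = i
    · subst hk
      rw [hrow_self]
      exact differentiableAt_const _
    · rw [hrow j k hk]
      exact (hasFDerivAt_jacobianMatrix_row hφ k s).differentiableAt
  simp_rw [adjugate_apply, fderiv_matrix_det_apply (hdiff _)]
  rw [Finset.sum_comm]
  refine Finset.sum_eq_zero fun k _ => ?_
  by_cases hk : k = i
  · subst hk
    refine Finset.sum_eq_zero fun j _ => det_eq_zero_of_row_eq_zero k fun l => ?_
    rw [updateRow_self, hrow_self]
    simp
  · simp_rw [hrow _ k hk]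
    exact (isSymm_fderiv_jacobianMatrix_row hφ k s).sum_det_updateRow_single_updateRow_eq_zero _
      (Ne.symm hk)

end Piola

/-- Piola identity: the cofactor matrix `cof F = (adj F)ᵀ` of the Jacobian of a
`C²` map is row-wise divergence free; in particular, if `det F ≠ 0`
everywhere, then `Div (det(F)·F^{−T}) = 0` row-wise. -/
theorem piola_identity {d : ℕ}
    (φ : EuclideanSpace ℝ (Fin d) → EuclideanSpace ℝ (Fin d))
    (hφ : ContDiff ℝ 2 φ) :
    (∀ (i : Fin d) (s : EuclideanSpace ℝ (Fin d)),
      ∑ j : Fin d,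
        fderiv ℝ (fun x => (Matrix.adjugate (jacobianMatrix φ x))ᵀ i j) s
          (EuclideanSpace.single j 1) = 0) ∧
    ((∀ x, (jacobianMatrix φ x).det ≠ 0) →
      ∀ (i : Fin d) (s : EuclideanSpace ℝ (Fin d)),
        ∑ j : Fin d,
          fderiv ℝ
            (fun x => ((jacobianMatrix φ x).det • ((jacobianMatrix φ x)⁻¹)ᵀ) i j) s
            (EuclideanSpace.single j 1) = 0) := by
  refine ⟨fun i s => sum_fderiv_adjugate_jacobianMatrix_eq_zero hφ i s, fun hdet i s => ?_⟩
  have h (x : EuclideanSpace ℝ (Fin d)) :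
      (jacobianMatrix φ x).det • ((jacobianMatrix φ x)⁻¹)ᵀ = (jacobianMatrix φ x).adjugateᵀ := by
    rw [inv_def, transpose_smul, smul_smul, Ring.mul_inverse_cancel _ (hdet x).isUnit, one_smul]
  simp_rw [h]
  exact sum_fderiv_adjugate_jacobianMatrix_eq_zero hφ i s
end
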